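/- Let H : ℕ → ℕ and suppose there exist a natural number m ≥ 1, D-periodic functions d_0,...,d_{m-1} : ℕ → ℤ, and α ∈ ℕ such that H(n) = ∑_{k=0}^{m-1} d_k(n)·n^k for all n ≥ α. Then for every w > 0, the function z ↦ ∑_{n=0}^∞ H(n)/(n+w)^z, initially defined for Re(z) > m, extends to a meromorphic function on ℂ whose poles are contained in {1, 2, ..., m} and are all simple. -/

import Mathlib

open Complex Filter

/-- Auxiliary predicate: the Dirichlet-type series with coefficients `a` continues nicely. -/
def ZBGood (w : ℝ) (m : ℕ) (a : ℕ → ℂ) : Prop :=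
  ∃ f : ℂ → ℂ,
    (∀ z : ℂ, (m : ℝ) < z.re →
      HasSum (fun n : ℕ => a n / (((n : ℝ) + w : ℝ) : ℂ) ^ z) (f z)) ∧
    (∀ z : ℂ, (¬ ∃ j : ℕ, 1 ≤ j ∧ j ≤ m ∧ z = (j : ℂ)) → AnalyticAt ℂ f z) ∧
    (∀ z : ℂ, ∃ c : ℂ, Tendsto (fun s => (s - z) * f s) (nhdsWithin z {z}ᶜ) (nhds c))

lemma ZB_tendsto_of_analytic {f : ℂ → ℂ} {z : ℂ} (hf : AnalyticAt ℂ f z) :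
    ∃ c : ℂ, Tendsto (fun s => (s - z) * f s) (nhdsWithin z {z}ᶜ) (nhds c) := by
  have h : ContinuousAt (fun s => (s - z) * f s) z :=
    (continuousAt_id.sub continuousAt_const).mul hf.continuousAt
  exact ⟨_, h.tendsto.mono_left nhdsWithin_le_nhds⟩

lemma ZB_analytic_cpow {x : ℝ} (hx : 0 < x) (z : ℂ) :
    AnalyticAt ℂ (fun s : ℂ => 1 / (x : ℂ) ^ s) z := by
  have hx0 : (x : ℂ) ≠ 0 := by exact_mod_cast hx.ne'
  have hd : Differentiable ℂ (fun s : ℂ => 1 / (x : ℂ) ^ s) := by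
    intro s
    refine (differentiableAt_const _).div ?_ ?_
    · exact differentiableAt_id.const_cpow (Or.inl hx0)
    · simp [Complex.cpow_eq_zero_iff, hx0]
  exact hd.analyticAt z

lemma ZBGood.add {w : ℝ} {m : ℕ} {a b : ℕ → ℂ} (ha : ZBGood w m a) (hb : ZBGood w m b) :
    ZBGood w m (fun n => a n + b n) := by
  obtain ⟨f, f1, f2, f3⟩ := ha
  obtain ⟨g, g1, g2, g3⟩ := hb
  refine ⟨fun z => f z + g z, fun z hz => ?_, fun z hz => (f2 z hz).add (g2 z hz), fun z => ?_⟩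
  · simpa only [add_div] using (f1 z hz).add (g1 z hz)
  · obtain ⟨c, hc⟩ := f3 z
    obtain ⟨e, he⟩ := g3 z
    exact ⟨c + e, by simpa only [mul_add] using hc.add he⟩

lemma ZBGood.smul {w : ℝ} {m : ℕ} {a : ℕ → ℂ} (ha : ZBGood w m a) (t : ℂ) :
    ZBGood w m (fun n => t * a n) := by
  obtain ⟨f, f1, f2, f3⟩ := ha
  refine ⟨fun z => t * f z, fun z hz => ?_, fun z hz => analyticAt_const.mul (f2 z hz),
    fun z => ?_⟩
  · simpa only [mul_div_assoc] using (f1 z hz).mul_left t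
  · obtain ⟨c, hc⟩ := f3 z
    exact ⟨t * c, by simpa only [mul_left_comm] using hc.const_mul t⟩

lemma ZBGood.mono {w : ℝ} {m k : ℕ} {a : ℕ → ℂ} (ha : ZBGood w m a) (h : m ≤ k) :
    ZBGood w k a := by
  obtain ⟨f, f1, f2, f3⟩ := ha
  refine ⟨f, fun z hz => f1 z (lt_of_le_of_lt (by exact_mod_cast h) hz), fun z hz => f2 z ?_, f3⟩
  rintro ⟨j, h1, h2, h3⟩
  exact hz ⟨j, h1, h2.trans h, h3⟩

lemma ZBGood.zero (w : ℝ) (m : ℕ) : ZBGood w m (fun _ => 0) :=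
  ⟨fun _ => 0, fun z _ => by simpa using hasSum_zero, fun _ _ => analyticAt_const,
    fun _ => ⟨0, by simp⟩⟩

lemma ZBGood.sum {w : ℝ} {m : ℕ} {ι : Type} (s : Finset ι) (a : ι → ℕ → ℂ)
    (h : ∀ i ∈ s, ZBGood w m (a i)) : ZBGood w m (fun n => ∑ i ∈ s, a i n) := by
  classical
  induction s using Finset.induction_on with
  | empty => simpa using ZBGood.zero w m
  | insert i s hi ih =>
    simp only [Finset.sum_insert hi]
    exact (h i (Finset.mem_insert_self i s)).add
      (ih fun j hj => h j (Finset.mem_insert_of_mem hj))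

lemma ZBGood.single {w : ℝ} (hw : 0 < w) (r : ℕ) :
    ZBGood w 0 (fun n => if n = r then 1 else 0) := by
  have hp : 0 < (r : ℝ) + w := by positivity
  refine ⟨fun z => 1 / (((r : ℝ) + w : ℝ) : ℂ) ^ z, fun z _ => ?_, fun z _ => ?_, fun z => ?_⟩
  · have := hasSum_single (f := fun n : ℕ => (if n = r then (1 : ℂ) else 0) /
      (((n : ℝ) + w : ℝ) : ℂ) ^ z) r (by intro n hn; simp [hn])
    simpa using this
  · exact ZB_analytic_cpow hp z
  · exact ZB_tendsto_of_analytic (ZB_analytic_cpow hp z)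

lemma ZBGood.finite {w : ℝ} (hw : 0 < w) (N : ℕ) (e : ℕ → ℂ) (he : ∀ n, N ≤ n → e n = 0) :
    ZBGood w 0 e := by
  have h := ZBGood.sum (w := w) (m := 0) (Finset.range N)
    (fun r n => e r * (if n = r then 1 else 0)) (fun r _ => (ZBGood.single hw r).smul (e r))
  convert h using 1
  funext n
  by_cases hn : n < N
  · simp [hn]
  · simp [hn, he n (not_lt.mp hn)]

lemma ZBGood.shift {w : ℝ} (hw : 0 < w) {m : ℕ} {a : ℕ → ℂ} (ha : ZBGood w m a) :
    ZBGood w (m + 1) (fun n => (((n : ℝ) + w : ℝ) : ℂ) * a n) := by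
  obtain ⟨f, f1, f2, f3⟩ := ha
  refine ⟨fun z => f (z - 1), fun z hz => ?_, fun z hz => ?_, fun z => ?_⟩
  · have h := f1 (z - 1) (by push_cast at hz; simp; linarith)
    convert h using 2 with n
    have hp : 0 < (n : ℝ) + w := by positivity
    have hx0 : (((n : ℝ) + w : ℝ) : ℂ) ≠ 0 := by exact_mod_cast hp.ne'
    have h2 : (((n : ℝ) + w : ℝ) : ℂ) ^ z ≠ 0 := by simp only [ne_eq, Complex.cpow_eq_zero_iff]; tauto
    rw [Complex.cpow_sub _ _ hx0, Complex.cpow_one]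
    field_simp
  · have h : AnalyticAt ℂ f (z - 1) := by
      apply f2
      rintro ⟨j, h1, h2, h3⟩
      refine hz ⟨j + 1, by omega, by omega, ?_⟩
      push_cast
      rw [← h3]; ring
    have hs : AnalyticAt ℂ (fun s : ℂ => s - 1) z := analyticAt_id.sub analyticAt_const
    exact AnalyticAt.fun_comp h hs
  · obtain ⟨c, hc⟩ := f3 (z - 1)
    refine ⟨c, ?_⟩
    have ht : Tendsto (fun s : ℂ => s - 1) (nhdsWithin z {z}ᶜ) (nhdsWithin (z - 1) {z - 1}ᶜ) := by
      refine tendsto_nhdsWithin_iff.mpr ⟨?_, ?_⟩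
      · exact (continuousAt_id.sub continuousAt_const).tendsto.mono_left nhdsWithin_le_nhds
      · filter_upwards [self_mem_nhdsWithin] with s hs
        simpa using hs
    have h := hc.comp ht
    convert h using 2 with s
    simp

lemma ZB_hurwitz_small {x : ℝ} (hx : 0 < x) (hx1 : x ≤ 1) : ZBGood x 1 (fun _ => 1) := by
  have han : ∀ z : ℂ, z ≠ 1 → AnalyticAt ℂ (HurwitzZeta.hurwitzZeta (x : UnitAddCircle)) z := by
    intro z hz
    have hd : DifferentiableOn ℂ (HurwitzZeta.hurwitzZeta (x : UnitAddCircle)) {1}ᶜ :=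
      fun s hs => (HurwitzZeta.differentiableAt_hurwitzZeta _ hs).differentiableWithinAt
    exact hd.analyticAt (isOpen_compl_singleton.mem_nhds hz)
  refine ⟨HurwitzZeta.hurwitzZeta (x : UnitAddCircle), fun z hz => ?_, fun z hz => ?_, fun z => ?_⟩
  · have h := HurwitzZeta.hasSum_hurwitzZeta_of_one_lt_re (a := x) ⟨hx.le, hx1⟩ (s := z)
      (by simpa using hz)
    simpa using h
  · exact han z fun h => hz ⟨1, le_rfl, le_rfl, by simpa using h⟩
  · by_cases h : z = 1
    · subst h
      exact ⟨1, HurwitzZeta.hurwitzZeta_residue_one _⟩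
    · exact ZB_tendsto_of_analytic (han z h)

lemma ZB_hurwitz_succ {x : ℝ} (hx : 0 < x) (h : ZBGood x 1 (fun _ => 1)) :
    ZBGood (x + 1) 1 (fun _ => 1) := by
  obtain ⟨f, f1, f2, f3⟩ := h
  refine ⟨fun z => f z - 1 / (x : ℂ) ^ z, fun z hz => ?_, fun z hz => ?_, fun z => ?_⟩
  · have h := (hasSum_nat_add_iff' 1).mpr (f1 z hz)
    have e1 : (fun n : ℕ => (1 : ℂ) / (((n : ℝ) + (x + 1) : ℝ) : ℂ) ^ z) =
        fun n : ℕ => (1 : ℂ) / ((((n + 1 : ℕ) : ℝ) + x : ℝ) : ℂ) ^ z := by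
      funext n
      have : (n : ℝ) + (x + 1) = ((n + 1 : ℕ) : ℝ) + x := by push_cast; ring
      rw [this]
    simp only [Finset.sum_range_one, Nat.cast_zero, zero_add] at h
    simp only [e1]
    exact h
  · exact (f2 z hz).sub (ZB_analytic_cpow hx z)
  · obtain ⟨c, hc⟩ := f3 z
    obtain ⟨e, he⟩ := ZB_tendsto_of_analytic (ZB_analytic_cpow hx z)
    exact ⟨c - e, by simpa only [mul_sub] using hc.sub he⟩

lemma ZB_hurwitz {x : ℝ} (hx : 0 < x) : ZBGood x 1 (fun _ => 1) := by
  have key : ∀ N : ℕ, ∀ x : ℝ, 0 < x → x ≤ N + 1 → ZBGood x 1 (fun _ => 1) := by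
    intro N
    induction N with
    | zero => intro x hx hx1; exact ZB_hurwitz_small hx (by simpa using hx1)
    | succ N ih =>
      intro x hx hx1
      by_cases h : x ≤ 1
      · exact ZB_hurwitz_small hx h
      · push_cast at hx1
        have := ZB_hurwitz_succ (x := x - 1) (by linarith) (ih _ (by linarith) (by linarith))
        simpa using this
  obtain ⟨N, hN⟩ := exists_nat_ge x
  exact key N x hx (by linarith)

lemma ZB_residue {w : ℝ} (hw : 0 < w) {D r : ℕ} (hr : r < D) :
    ZBGood w 1 (fun n => if n % D = r then 1 else 0) := by
  have hD : 0 < D := by omega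
  have hDR : (0 : ℝ) < D := by exact_mod_cast hD
  obtain ⟨f, f1, f2, f3⟩ := ZB_hurwitz (x := (r + w) / D) (by positivity)
  have hA := fun z => ZB_analytic_cpow hDR z
  refine ⟨fun z => 1 / ((D : ℝ) : ℂ) ^ z * f z, fun z hz => ?_,
    fun z hz => (hA z).mul (f2 z hz), fun z => ?_⟩
  · have h := (f1 z hz).mul_left (1 / ((D : ℝ) : ℂ) ^ z)
    have hinj : Function.Injective (fun q : ℕ => D * q + r) := by
      intro p q hpq
      simpa [hD.ne'] using hpq
    rw [← hinj.hasSum_iff]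
    · refine (congrArg (fun g => HasSum g (1 / ((D : ℝ) : ℂ) ^ z * f z)) (funext fun q => ?_)).mpr h
      have h1 : (D * q + r) % D = r := by
        rw [Nat.mul_add_mod, Nat.mod_eq_of_lt hr]
      have h2 : (((D * q + r : ℕ) : ℝ) + w) = D * ((q : ℝ) + (r + w) / D) := by
        push_cast
        field_simp
        ring
      simp only [Function.comp, h1, if_true]
      rw [h2, Complex.ofReal_mul, Complex.mul_cpow_ofReal_nonneg hDR.le (by positivity)]
      rw [one_div_mul_one_div]
    · intro n hn
      have : n % D ≠ r := by
        intro h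
        exact hn ⟨n / D, by simp only [← h]; exact Nat.div_add_mod n D⟩
      simp [this]
  · obtain ⟨c, hc⟩ := f3 z
    refine ⟨1 / ((D : ℝ) : ℂ) ^ z * c, ?_⟩
    have := ((hA z).continuousAt.tendsto.mono_left (nhdsWithin_le_nhds (s := {z}ᶜ))).mul hc
    simpa only [mul_left_comm] using this

lemma ZB_periodic {w : ℝ} (hw : 0 < w) {D : ℕ} (hD : 1 ≤ D) (c : ℕ → ℂ)
    (hc : ∀ n, c (n + D) = c n) : ZBGood w 1 c := by
  have h := ZBGood.sum (w := w) (m := 1) (Finset.range D)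
    (fun r n => c r * (if n % D = r then 1 else 0))
    (fun r hr => (ZB_residue hw (Finset.mem_range.mp hr)).smul (c r))
  convert h using 1
  funext n
  have hp : Function.Periodic c D := hc
  have hlt : n % D < D := Nat.mod_lt _ (by omega)
  simp [hlt, hp.map_mod_nat n]

lemma ZB_pow {w : ℝ} (hw : 0 < w) {c : ℕ → ℂ} (hc : ZBGood w 1 c) (k : ℕ) :
    ZBGood w (k + 1) (fun n => c n * (n : ℂ) ^ k) := by
  induction k with
  | zero => simpa using hc
  | succ k ih =>
    have h := (ih.shift hw).add ((ih.smul (-(w : ℂ))).mono (Nat.le_succ _))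
    convert h using 1
    funext n
    push_cast
    ring

/-- If `H` agrees with a quasi-polynomial of degree `m-1` and period `D` for `n ≥ α`, then the
Zeta-Barnes type function `z ↦ ∑_{n≥0} H(n)/(n+w)^z`, defined for `Re z > m`, extends to a
meromorphic function on `ℂ` whose poles are contained in `{1,…,m}` and are all simple. -/
theorem zeta_barnes_meromorphic (H : ℕ → ℕ) (m D α : ℕ) (hm : 1 ≤ m) (hD : 1 ≤ D)
    (d : ℕ → ℕ → ℤ) (hper : ∀ k, k < m → ∀ n, d k (n + D) = d k n)
    (hH : ∀ n, α ≤ n → (H n : ℤ) = ∑ k ∈ Finset.range m, d k n * (n : ℤ) ^ k)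
    (w : ℝ) (hw : 0 < w) :
    ∃ f : ℂ → ℂ,
      (∀ z : ℂ, (m : ℝ) < z.re →
          f z = ∑' n : ℕ, (H n : ℂ) / (((n : ℝ) + w : ℝ) : ℂ) ^ z) ∧
      (∀ z : ℂ, z ∉ {z : ℂ | ∃ j : ℕ, 1 ≤ j ∧ j ≤ m ∧ z = (j : ℂ)} → AnalyticAt ℂ f z) ∧
      (∀ z ∈ {z : ℂ | ∃ j : ℕ, 1 ≤ j ∧ j ≤ m ∧ z = (j : ℂ)},
          ∃ c : ℂ, Tendsto (fun s => (s - z) * f s) (nhdsWithin z {z}ᶜ) (nhds c)) := by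
  have hg : ZBGood w m (fun n => (H n : ℂ)) := by
    have h1 : ZBGood w m (fun n => ∑ k ∈ Finset.range m, (d k n : ℂ) * (n : ℂ) ^ k) := by
      refine ZBGood.sum _ (fun k n => (d k n : ℂ) * (n : ℂ) ^ k) fun k hk => ?_
      have hk := Finset.mem_range.mp hk
      exact (ZB_pow hw (ZB_periodic hw hD (fun n => (d k n : ℂ))
        (fun n => by rw [hper k hk n])) k).mono hk
    have h2 : ZBGood w m
        (fun n => (H n : ℂ) - ∑ k ∈ Finset.range m, (d k n : ℂ) * (n : ℂ) ^ k) := by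
      refine (ZBGood.finite hw α _ fun n hn => ?_).mono (Nat.zero_le m)
      have := congrArg (Int.cast (R := ℂ)) (hH n hn)
      push_cast at this
      rw [this, sub_self]
    simpa using h1.add h2
  obtain ⟨f, f1, f2, f3⟩ := hg
  exact ⟨f, fun z hz => (f1 z hz).tsum_eq.symm, fun z hz => f2 z hz, fun z _ => f3 z⟩
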